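/- There is a constant A ≥ 1, depending only on n, J, S and on bounds for g, such that the following holds. For each ν let V_ν = (J^# N_ν, −⟨Γ(y̲^ν), N_ν⟩) ∈ ℝ^{2n+1} (coordinates (x,u)). Then for all y̲ ∈ Q_ν, all y_{2n} with |y_{2n}| ≤ 1, all v ∈ ℝ, all (x,u) with |x| + |u − u°| ≤ 2^{−l}, all σ with 2^{−l−2} ≤ |σ| ≤ 2^{−l+2} and all τ with 1/4 ≤ |τ| ≤ 4: |⟨V_ν, ∇_{(x,u)}Φ(σ,τ,x,u,y,v)⟩| ≤ A · (δ₁² + |x_{2n} − y_{2n} − g(x̲ − y̲)|). -/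

import Mathlib

open MeasureTheory

/-- First `2n−1` coordinates of a vector in `ℝ^{2n}`. -/
def und {n : ℕ} (x : Fin (2 * n) → ℝ) : Fin (2 * n - 1) → ℝ :=
  fun i => x (Fin.castLE (by omega) i)

/-- Last coordinate of a vector in `ℝ^{2n}`. -/
def lastC {n : ℕ} (x : Fin (2 * n) → ℝ) : ℝ :=
  if h : 2 * n - 1 < 2 * n then x ⟨2 * n - 1, h⟩ else 0

/-- Pad a vector in `ℝ^{2n-1}` by a last coordinate to obtain a vector in `ℝ^{2n}`. -/
def pad {n : ℕ} (w : Fin (2 * n - 1) → ℝ) (t : ℝ) : Fin (2 * n) → ℝ :=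
  fun j => if h : (j : ℕ) < 2 * n - 1 then w ⟨j, h⟩ else t

/-- The bilinear form `xᵀJy`. -/
def bilJ {d : ℕ} (J : Matrix (Fin d) (Fin d) ℝ) (x y : Fin d → ℝ) : ℝ :=
  ∑ i, ∑ j, x i * J i j * y j

/-- Euclidean norm of a vector in `Fin d → ℝ`. -/
noncomputable def eucNorm {d : ℕ} (x : Fin d → ℝ) : ℝ :=
  Real.sqrt (∑ i, (x i) ^ 2)

/-- Nondegeneracy of the Hessian of `g` at `w`: `det D²g(w) ≠ 0`. -/
def HessNondeg {m : ℕ} (g : (Fin m → ℝ) → ℝ) (w : Fin m → ℝ) : Prop :=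
  (Matrix.of fun i j : Fin m =>
    iteratedFDeriv ℝ 2 g w ![Pi.single i 1, Pi.single j 1]).det ≠ 0

/-- The axis-parallel cube with corner `c` and side length `δ`. -/
def cube {m : ℕ} (c : Fin m → ℝ) (δ : ℝ) : Set (Fin m → ℝ) :=
  {y | ∀ i, c i ≤ y i ∧ y i ≤ c i + δ}

/-- `Γ(y̲) = (y̲, −g(−y̲)) ∈ ℝ^{2n}`. -/
noncomputable def Gam {n : ℕ} (g : (Fin (2 * n - 1) → ℝ) → ℝ)
    (w : Fin (2 * n - 1) → ℝ) : Fin (2 * n) → ℝ :=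
  pad w (-(g (-w)))

/-- `N(y̲) = e_{2n} − Σ_{i<2n} ∂_i g(−y̲) e_i`. -/
noncomputable def Nvec {n : ℕ} (g : (Fin (2 * n - 1) → ℝ) → ℝ)
    (w : Fin (2 * n - 1) → ℝ) : Fin (2 * n) → ℝ :=
  fun j => if h : (j : ℕ) < 2 * n - 1 then
    -(fderiv ℝ g (-w) (Pi.single (⟨j, h⟩ : Fin (2 * n - 1)) 1)) else 1

/-- The phase `Φ(σ,τ,x,u,y,v) = σ(x_{2n}−y_{2n}−g(x̲−y̲)) + τ(u−v+xᵀJy) + (τ/2)⟨Sx,x⟩`,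
as a function of `(x,u)`. -/
noncomputable def PhiFun {n : ℕ} (g : (Fin (2 * n - 1) → ℝ) → ℝ)
    (J S : Matrix (Fin (2 * n)) (Fin (2 * n)) ℝ)
    (σ τ : ℝ) (y : Fin (2 * n) → ℝ) (v : ℝ) :
    ((Fin (2 * n) → ℝ) × ℝ) → ℝ :=
  fun p => σ * (lastC p.1 - lastC y - g (und p.1 - und y))
    + τ * (p.2 - v + bilJ J p.1 y) + τ / 2 * bilJ S p.1 p.1

/-- `Ψ(σ,τ,x,u,y,v,ξ) = Φ(σ,τ,x,u,y,v) − ⟨x,ξ̄⟩ − u ξ_{2n+1}`, as a function of `(x,u)`. -/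
noncomputable def PsiFun {n : ℕ} (g : (Fin (2 * n - 1) → ℝ) → ℝ)
    (J S : Matrix (Fin (2 * n)) (Fin (2 * n)) ℝ)
    (σ τ : ℝ) (y : Fin (2 * n) → ℝ) (v : ℝ)
    (ξ : (Fin (2 * n) → ℝ) × ℝ) :
    ((Fin (2 * n) → ℝ) × ℝ) → ℝ :=
  fun p => PhiFun g J S σ τ y v p - (∑ i, p.1 i * ξ.1 i) - p.2 * ξ.2

open Matrix in
/-- The matrix form of `bilJ`. -/
lemma bilJ_eq_dotProduct {d : ℕ} (B : Matrix (Fin d) (Fin d) ℝ) (x y : Fin d → ℝ) :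
    bilJ B x y = x ⬝ᵥ B *ᵥ y := by
  simp [bilJ, dotProduct, mulVec, Finset.mul_sum, mul_assoc]

/-- A bilinear form is bounded with respect to the sup norm. -/
lemma exists_abs_bilJ_le {d : ℕ} (B : Matrix (Fin d) (Fin d) ℝ) :
    ∃ C : ℝ, 0 ≤ C ∧ ∀ x y : Fin d → ℝ, |bilJ B x y| ≤ C * ‖x‖ * ‖y‖ := by
  refine ⟨∑ i, ∑ j, |B i j|, by positivity, fun x y => ?_⟩
  simp only [bilJ, Finset.sum_mul]
  refine (Finset.abs_sum_le_sum_abs _ _).trans (Finset.sum_le_sum fun i _ => ?_)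
  refine (Finset.abs_sum_le_sum_abs _ _).trans (Finset.sum_le_sum fun j _ => ?_)
  rw [abs_mul, abs_mul, mul_comm |x i|]
  have hx := norm_le_pi_norm x i
  have hy := norm_le_pi_norm y j
  rw [Real.norm_eq_abs] at hx hy
  gcongr

open Matrix in
/-- The bilinear form of a skew-symmetric matrix is alternating. -/
lemma bilJ_self_eq_zero {d : ℕ} {B : Matrix (Fin d) (Fin d) ℝ} (hB : B.transpose = -B)
    (x : Fin d → ℝ) : bilJ B x x = 0 := by
  have h : x ⬝ᵥ B *ᵥ x = x ⬝ᵥ Bᵀ *ᵥ x := by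
    rw [dotProduct_mulVec, ← mulVec_transpose, dotProduct_comm]
  rw [hB, neg_mulVec, dotProduct_neg] at h
  rw [bilJ_eq_dotProduct]
  linarith

/-- Each coordinate is bounded by the Euclidean norm. -/
lemma abs_le_eucNorm {d : ℕ} (x : Fin d → ℝ) (i : Fin d) : |x i| ≤ eucNorm x := by
  rw [eucNorm, ← Real.sqrt_sq_eq_abs]
  exact Real.sqrt_le_sqrt
    (Finset.single_le_sum (f := fun i => x i ^ 2) (fun i _ => sq_nonneg _) (Finset.mem_univ i))

lemma norm_le_eucNorm {d : ℕ} (x : Fin d → ℝ) : ‖x‖ ≤ eucNorm x :=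
  (pi_norm_le_iff_of_nonneg (Real.sqrt_nonneg _)).2 fun i => abs_le_eucNorm x i

lemma norm_und_le {n : ℕ} (x : Fin (2 * n) → ℝ) : ‖und x‖ ≤ ‖x‖ :=
  (pi_norm_le_iff_of_nonneg (norm_nonneg _)).2 fun _ => norm_le_pi_norm x _

lemma und_pad {n : ℕ} (w : Fin (2 * n - 1) → ℝ) (t : ℝ) : und (pad (n := n) w t) = w := by
  funext i
  simp [und, pad]

lemma lastC_pad {n : ℕ} (hn : 0 < n) (w : Fin (2 * n - 1) → ℝ) (t : ℝ) :
    lastC (pad (n := n) w t) = t := by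
  have h : 2 * n - 1 < 2 * n := by omega
  simp [lastC, pad, h]

lemma sum_fin_eq_sum_castLE_add {M m : ℕ} (h : M = m + 1) (f : Fin M → ℝ) :
    ∑ j, f j = ∑ i : Fin m, f (Fin.castLE (by omega) i) + f ⟨m, by omega⟩ := by
  subst h
  exact Fin.sum_univ_castSucc f

/-- Pairing with `Nvec g w` in terms of the derivative of `g` at `-w`. -/
lemma dotProduct_Nvec {n : ℕ} (hn : 0 < n) (g : (Fin (2 * n - 1) → ℝ) → ℝ)
    (w : Fin (2 * n - 1) → ℝ) (z : Fin (2 * n) → ℝ) :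
    z ⬝ᵥ Nvec g w = lastC z - fderiv ℝ g (-w) (und z) := by
  have h : 2 * n - 1 < 2 * n := by omega
  have hsum := (fderiv ℝ g (-w)).toLinearMap.pi_apply_eq_sum_univ (und z)
  simp only [ContinuousLinearMap.coe_coe, smul_eq_mul] at hsum
  have hsingle : ∀ i : Fin (2 * n - 1),
      (fun j => if i = j then (1 : ℝ) else 0) = Pi.single i 1 := by
    intro i
    funext j
    simp [Pi.single_apply, eq_comm]
  simp only [hsingle] at hsum
  rw [dotProduct, sum_fin_eq_sum_castLE_add (m := 2 * n - 1) (by omega), hsum]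
  simp only [Nvec, lastC, und, h, dif_pos, Fin.val_castLE, Fin.is_lt, Fin.eta, mul_neg,
    Finset.sum_neg_distrib, lt_irrefl, dif_neg, not_false_eq_true, mul_one]
  ring

lemma one_le_eucNorm_Nvec {n : ℕ} (hn : 0 < n) (g : (Fin (2 * n - 1) → ℝ) → ℝ)
    (w : Fin (2 * n - 1) → ℝ) : 1 ≤ eucNorm (Nvec g w) := by
  have h := abs_le_eucNorm (Nvec g w) ⟨2 * n - 1, by omega⟩
  simpa [Nvec] using h

/-- The map `w ↦ Nvec g w` varies no more than the derivative of `g`. -/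
lemma norm_Nvec_sub_le {n : ℕ} (g : (Fin (2 * n - 1) → ℝ) → ℝ)
    (w w' : Fin (2 * n - 1) → ℝ) :
    ‖Nvec g w - Nvec g w'‖ ≤ ‖fderiv ℝ g (-w) - fderiv ℝ g (-w')‖ := by
  refine (pi_norm_le_iff_of_nonneg (norm_nonneg _)).2 fun j => ?_
  by_cases h : (j : ℕ) < 2 * n - 1
  · have := (fderiv ℝ g (-w) - fderiv ℝ g (-w')).le_opNorm
      (Pi.single (⟨j, h⟩ : Fin (2 * n - 1)) 1)
    rw [Pi.norm_single, norm_one, mul_one, sub_apply, norm_sub_rev] at this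
    simpa [Nvec, h, neg_add_eq_sub] using this
  · simp [Nvec, h]

lemma Nvec_zero {n : ℕ} (hn : 0 < n) {g : (Fin (2 * n - 1) → ℝ) → ℝ}
    (hgrad0 : fderiv ℝ g 0 = 0) :
    Nvec g 0 = Pi.single (⟨2 * n - 1, by omega⟩ : Fin (2 * n)) 1 := by
  funext j
  by_cases h : (j : ℕ) < 2 * n - 1
  · have hj : j ≠ ⟨2 * n - 1, by omega⟩ := fun e => by simp [e] at h
    simp [Nvec, h, hgrad0, hj]
  · have hj : j = ⟨2 * n - 1, by omega⟩ := Fin.ext (by have := j.2; simp only; omega)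
    simp [Nvec, hj]

/-- The derivative of a smooth function is Lipschitz on closed balls. -/
lemma exists_lipschitz_fderiv {m : ℕ} {g : (Fin m → ℝ) → ℝ} (hg : ContDiff ℝ (⊤ : ℕ∞) g)
    (R : ℝ) : ∃ L : ℝ, 0 ≤ L ∧ ∀ a b : Fin m → ℝ, ‖a‖ ≤ R → ‖b‖ ≤ R →
      ‖fderiv ℝ g b - fderiv ℝ g a‖ ≤ L * ‖b - a‖ := by
  have h0 : ContDiff ℝ 2 g := by exact_mod_cast contDiff_infty.1 hg 2
  have h1 : ContDiff ℝ 1 (fderiv ℝ g) := h0.fderiv_right (by norm_num)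
  have h2 : Continuous (fderiv ℝ (fderiv ℝ g)) := h1.continuous_fderiv (by simp)
  obtain ⟨L, hL⟩ := (isCompact_closedBall (0 : Fin m → ℝ) R).exists_bound_of_continuousOn
    (f := fderiv ℝ (fderiv ℝ g)) h2.continuousOn
  refine ⟨max L 0, le_max_right _ _, fun a b ha hb => ?_⟩
  exact (convex_closedBall (0 : Fin m → ℝ) R).norm_image_sub_le_of_norm_fderiv_le
    (fun x _ => (h1.differentiable (by simp)).differentiableAt)
    (fun x hx => (hL x hx).trans (le_max_left _ _)) (by simpa using ha) (by simpa using hb)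

/-- A first-order Taylor estimate, with the derivative taken at a third point `p`. -/
lemma abs_sub_sub_fderiv_le {m : ℕ} {g : (Fin m → ℝ) → ℝ} (hg : Differentiable ℝ g)
    {p a b : Fin m → ℝ} {C r R : ℝ} (hC : 0 ≤ C) (hR : ∀ w w' : Fin m → ℝ, ‖w‖ ≤ R → ‖w'‖ ≤ R →
      ‖fderiv ℝ g w' - fderiv ℝ g w‖ ≤ C * ‖w' - w‖)
    (hp : ‖p‖ ≤ R) (ha : ‖a‖ ≤ R) (hb : ‖b‖ ≤ R) (hpa : ‖a - p‖ ≤ r) (hpb : ‖b - p‖ ≤ r) :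
    |g b - g a - fderiv ℝ g p (b - a)| ≤ C * r * ‖b - a‖ := by
  have hconv : Convex ℝ (Metric.closedBall (0 : Fin m → ℝ) R ∩ Metric.closedBall p r) :=
    (convex_closedBall _ _).inter (convex_closedBall _ _)
  refine hconv.norm_image_sub_le_of_norm_fderiv_le' (fun x _ => hg.differentiableAt)
    (fun x hx => ?_) ⟨by simpa using ha, by simpa [dist_eq_norm] using hpa⟩
    ⟨by simpa using hb, by simpa [dist_eq_norm] using hpb⟩
  refine (hR p x hp (by simpa using hx.1)).trans ?_
  have : ‖x - p‖ ≤ r := by simpa [dist_eq_norm] using hx.2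
  gcongr

open Matrix in
/-- The directional derivative of the phase. -/
lemma fderiv_PhiFun_apply {n : ℕ} (hn : 0 < n) {g : (Fin (2 * n - 1) → ℝ) → ℝ}
    (hg : Differentiable ℝ g) {J S : Matrix (Fin (2 * n)) (Fin (2 * n)) ℝ}
    (hS : S.transpose = S) (σ τ : ℝ) (y : Fin (2 * n) → ℝ) (v : ℝ)
    (x z : Fin (2 * n) → ℝ) (u t : ℝ) :
    fderiv ℝ (PhiFun g J S σ τ y v) (x, u) (z, t) =
      σ * (z ⬝ᵥ Nvec g (und y - und x)) + τ * (t + z ⬝ᵥ J *ᵥ y + z ⬝ᵥ S *ᵥ x) := by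
  have h : 2 * n - 1 < 2 * n := by omega
  have hdiff : DifferentiableAt ℝ (PhiFun g J S σ τ y v) (x, u) := by
    unfold PhiFun lastC und bilJ
    simp only [h, dif_pos]
    have : Differentiable ℝ fun p : (Fin (2 * n) → ℝ) × ℝ =>
        ((fun i => p.1 (Fin.castLE (by omega) i)) - fun i => y (Fin.castLE (by omega) i) :
          Fin (2 * n - 1) → ℝ) := by
      refine Differentiable.sub ?_ (differentiable_const _)
      fun_prop
    have := hg.comp this
    simp only [Function.comp_def] at this
    fun_prop
  rw [← hdiff.lineDeriv_eq_fderiv]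
  refine HasLineDerivAt.lineDeriv ?_
  unfold HasLineDerivAt
  have hsymm : x ⬝ᵥ S *ᵥ z = z ⬝ᵥ S *ᵥ x := by
    rw [dotProduct_mulVec, ← mulVec_transpose, hS, dotProduct_comm]
  have hline : (fun s : ℝ => PhiFun g J S σ τ y v ((x, u) + s • (z, t))) = fun s : ℝ =>
      σ * (lastC x + s * lastC z - lastC y - g ((und x - und y) + s • und z))
        + τ * (u + s * t - v + (x ⬝ᵥ J *ᵥ y + s * (z ⬝ᵥ J *ᵥ y)))
        + τ / 2 * (x ⬝ᵥ S *ᵥ x + 2 * s * (z ⬝ᵥ S *ᵥ x) + s ^ 2 * (z ⬝ᵥ S *ᵥ z)) := by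
    funext s
    have hund : und (x + s • z) - und y = (und x - und y) + s • und z := by
      funext i
      simp [und]
      ring
    simp only [PhiFun, Prod.smul_mk, Prod.mk_add_mk, bilJ_eq_dotProduct, hund, mulVec_add,
      mulVec_smul, add_dotProduct, dotProduct_add, smul_dotProduct, dotProduct_smul, hsymm,
      smul_eq_mul]
    simp only [lastC, h, dif_pos, Pi.add_apply, Pi.smul_apply, smul_eq_mul]
    ring
  rw [hline, dotProduct_Nvec hn, neg_sub]
  have hgl : HasDerivAt (fun s : ℝ => g ((und x - und y) + s • und z))
      (fderiv ℝ g (und x - und y) (und z)) 0 :=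
    (hg (und x - und y)).hasFDerivAt.hasLineDerivAt (und z)
  have hid := hasDerivAt_id' (0 : ℝ)
  have h1 := ((((hid.mul_const (lastC z)).const_add (lastC x)).sub_const (lastC y)).sub
    hgl).const_mul σ
  have h2 := (((((hid.mul_const t).const_add u).sub_const v).add
    ((hid.mul_const (z ⬝ᵥ J *ᵥ y)).const_add (x ⬝ᵥ J *ᵥ y)))).const_mul τ
  have h3 := (((((hid.const_mul 2).mul_const (z ⬝ᵥ S *ᵥ x)).const_add (x ⬝ᵥ S *ᵥ x)).add
    ((hid.pow 2).mul_const (z ⬝ᵥ S *ᵥ z)))).const_mul (τ / 2)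
  convert (h1.add h2).add h3 using 1
  · funext s
    simp only [Pi.add_apply, Pi.sub_apply, Pi.pow_apply]
  · norm_num
    ring

lemma norm_sub_le_of_mem_cube {m : ℕ} {c : Fin m → ℝ} {δ : ℝ} (hδ : 0 ≤ δ) {a b : Fin m → ℝ}
    (ha : a ∈ cube c δ) (hb : b ∈ cube c δ) : ‖a - b‖ ≤ δ := by
  refine (pi_norm_le_iff_of_nonneg hδ).2 fun i => ?_
  rw [Pi.sub_apply, Real.norm_eq_abs, abs_le]
  constructor <;> linarith [(ha i).1, (ha i).2, (hb i).1, (hb i).2]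

set_option maxHeartbeats 400000 in
/-- the normal directional derivative of the modified phase `Φ` satisfies
`|⟨V_ν, ∇_{(x,u)}Φ⟩| ≤ A(δ₁² + |x_{2n}−y_{2n}−g(x̲−y̲)|)` on the admissible ranges of
parameters, where `V_ν = (J^# N_ν, −⟨Γ(y̲^ν), N_ν⟩)` and `A` depends only on `n`, `J`,
`S` and bounds for `g`. -/
theorem stmt11 (n : ℕ) (hn : 2 ≤ n)
    (J : Matrix (Fin (2 * n)) (Fin (2 * n)) ℝ)
    (hJskew : J.transpose = -J) (hJinv : IsUnit J.det)
    (g : (Fin (2 * n - 1) → ℝ) → ℝ) (hg : ContDiff ℝ (⊤ : ℕ∞) g)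
    (hgrad0 : fderiv ℝ g 0 = 0)
    (hHess : ∀ w, eucNorm w ≤ 1 → HessNondeg g w)
    (S : Matrix (Fin (2 * n)) (Fin (2 * n)) ℝ)
    (hSsym : S.transpose = S) (hSinv : IsUnit S.det)
    (hSe : S.mulVec ((J⁻¹).transpose.mulVec
        (Pi.single (⟨2 * n - 1, by omega⟩ : Fin (2 * n)) 1))
      = -(Pi.single (⟨2 * n - 1, by omega⟩ : Fin (2 * n)) 1)) :
    ∃ A : ℝ, 1 ≤ A ∧
      ∀ (k l : ℕ), 1 ≤ l → 3 * l ≤ k →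
      ∀ δ₀ δ₁ : ℝ, (2 : ℝ) ^ (-(l : ℤ)) < δ₀ → δ₀ ≤ 1 → δ₁ < δ₀ →
        Real.sqrt ((2 : ℝ) ^ (-(l : ℤ)) * δ₀) ≤ δ₁ →
      ∀ c : Fin (2 * n - 1) → ℝ,
        cube c δ₁ ⊆ {y | ∀ i, |y i| ≤ δ₀} →
      ∀ yν ∈ cube c δ₁,
      ∀ u₀ : ℝ, |u₀| ≤ 1 →
      ∀ yb ∈ cube c δ₁, ∀ y2n : ℝ, |y2n| ≤ 1 → ∀ v : ℝ,
      ∀ (x : Fin (2 * n) → ℝ) (u : ℝ),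
        eucNorm x + |u - u₀| ≤ (2 : ℝ) ^ (-(l : ℤ)) →
      ∀ σ : ℝ, (2 : ℝ) ^ (-(l : ℤ) - 2) ≤ |σ| → |σ| ≤ (2 : ℝ) ^ (-(l : ℤ) + 2) →
      ∀ τ : ℝ, 1 / 4 ≤ |τ| → |τ| ≤ 4 →
        |fderiv ℝ (PhiFun g J S σ τ (pad yb y2n) v) (x, u)
            ((J⁻¹).transpose.mulVec (fun j => Nvec g yν j / eucNorm (Nvec g yν)),
              -(∑ j, Gam g yν j * (Nvec g yν j / eucNorm (Nvec g yν))))|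
          ≤ A * (δ₁ ^ 2 + |lastC x - y2n - g (und x - yb)|) := by
  have hn0 : 0 < n := by omega
  have hgd : Differentiable ℝ g := hg.differentiable (by simp)
  obtain ⟨L, hL0, hL⟩ := exists_lipschitz_fderiv hg 2
  obtain ⟨C₁, hC₁0, hC₁⟩ := exists_abs_bilJ_le J⁻¹
  obtain ⟨C₂, hC₂0, hC₂⟩ := exists_abs_bilJ_le (J⁻¹ * S)
  refine ⟨5 + 8 * C₁ * (1 + L) * L + 12 * L + 4 * C₂ * L, by
    have : 0 ≤ 8 * C₁ * (1 + L) * L + 12 * L + 4 * C₂ * L := by positivity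
    linarith, ?_⟩
  intro k l _ _ δ₀ δ₁ hlδ hδ₀ _ hsq c hc yν hyν u₀ _ yb hyb y2n _ v x u hxu σ _ hσ τ _ hτ
  rw [zpow_add₀ (by norm_num)] at hσ
  set ε : ℝ := (2 : ℝ) ^ (-(l : ℤ)) with hε
  have hε0 : 0 < ε := by positivity
  have hδ₀0 : 0 < δ₀ := hε0.trans hlδ
  have hδ₁0 : 0 ≤ δ₁ := (Real.sqrt_nonneg _).trans hsq
  have hεδ : ε * δ₀ ≤ δ₁ ^ 2 := (Real.sqrt_le_left hδ₁0).1 hsq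
  have hεδ₁ : ε ≤ δ₁ := by
    refine le_of_sq_le_sq ?_ hδ₁0
    nlinarith
  have hσ4 : |σ| ≤ 4 * ε := by norm_num at hσ; linarith
  have hx : ‖x‖ ≤ ε := (norm_le_eucNorm x).trans (by linarith [abs_nonneg (u - u₀)])
  have hux : ‖und x‖ ≤ ε := (norm_und_le x).trans hx
  have hyb0 : ‖yb‖ ≤ δ₀ := (pi_norm_le_iff_of_nonneg hδ₀0.le).2 fun i => hc hyb i
  have hyν0 : ‖yν‖ ≤ δ₀ := (pi_norm_le_iff_of_nonneg hδ₀0.le).2 fun i => hc hyν i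
  have hyy : ‖yb - yν‖ ≤ δ₁ := norm_sub_le_of_mem_cube hδ₁0 hyb hyν
  have hxy : ‖und x - yb‖ ≤ δ₀ + ε := (norm_sub_le _ _).trans (by linarith)
  set N := Nvec g yν with hN
  set E : Fin (2 * n) → ℝ := Pi.single (⟨2 * n - 1, by omega⟩ : Fin (2 * n)) 1 with hE
  have hr : 1 ≤ eucNorm N := one_le_eucNorm_Nvec hn0 g yν
  have hr0 : eucNorm N ≠ 0 := by linarith
  have hNE : ‖N - E‖ ≤ L * δ₀ := by
    rw [hN, hE, ← Nvec_zero hn0 hgrad0]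
    refine (norm_Nvec_sub_le g yν 0).trans ((hL _ _ (by simp) ?_).trans ?_)
    · rw [norm_neg]; linarith
    · rw [neg_zero, sub_zero, norm_neg]; gcongr
  have hE1 : ‖E‖ = 1 := by rw [hE, Pi.norm_single, norm_one]
  have hN1 : ‖N‖ ≤ 1 + L := by
    have h1 := norm_add_le (N - E) E
    rw [sub_add_cancel, hE1] at h1
    nlinarith
  have hNM : ‖Nvec g (yb - und x) - N‖ ≤ L * (2 * δ₁) := by
    refine (norm_Nvec_sub_le g _ _).trans ((hL _ _ ?_ ?_).trans ?_)
    · rw [norm_neg]; linarith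
    · rw [neg_sub]; linarith
    · have h1 : -(yb - und x) - -yν = und x - (yb - yν) := by abel
      rw [h1]
      have := norm_sub_le (und x) (yb - yν)
      gcongr
      linarith
  -- the term carrying `σ`
  have hJ' : (J⁻¹).transpose = -J⁻¹ := by
    have h1 : (J⁻¹).transpose = (-J)⁻¹ := by rw [Matrix.transpose_nonsing_inv, hJskew]
    rw [h1]
    refine Matrix.inv_eq_left_inv ?_
    rw [neg_mul_neg, Matrix.nonsing_inv_mul J hJinv]
  have hdot : ∀ w : Fin (2 * n) → ℝ, (J⁻¹).transpose.mulVec N ⬝ᵥ w = bilJ J⁻¹ N w := by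
    intro w
    rw [bilJ_eq_dotProduct, Matrix.mulVec_transpose, Matrix.dotProduct_mulVec]
  have hσterm : |bilJ J⁻¹ N (Nvec g (yb - und x))| ≤ C₁ * (1 + L) * (L * (2 * δ₁)) := by
    have h1 : bilJ J⁻¹ N (Nvec g (yb - und x)) = bilJ J⁻¹ N (Nvec g (yb - und x) - N) := by
      have h0 := bilJ_self_eq_zero hJ' N
      rw [bilJ_eq_dotProduct] at h0 ⊢
      rw [bilJ_eq_dotProduct, Matrix.mulVec_sub, dotProduct_sub, h0, sub_zero]
    rw [h1]
    refine (hC₁ _ _).trans ?_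
    gcongr
  -- the term carrying `S`
  have hSterm : |bilJ J⁻¹ N (S.mulVec x) + lastC x| ≤ C₂ * (L * δ₀) * ε := by
    have h1 : bilJ J⁻¹ N (S.mulVec x) + lastC x = bilJ (J⁻¹ * S) (N - E) x := by
      have h2 : bilJ (J⁻¹ * S) E x = -lastC x := by
        rw [bilJ_eq_dotProduct, ← Matrix.mulVec_mulVec, Matrix.dotProduct_mulVec,
          ← Matrix.mulVec_transpose, Matrix.dotProduct_mulVec, ← Matrix.mulVec_transpose,
          hSsym, hSe, neg_dotProduct, single_dotProduct, one_mul, lastC,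
          dif_pos (by omega)]
      rw [bilJ_eq_dotProduct] at h2 ⊢
      rw [bilJ_eq_dotProduct, sub_dotProduct, h2, Matrix.mulVec_mulVec]
      ring
    rw [h1]
    refine (hC₂ _ _).trans ?_
    gcongr
  -- Taylor expansion of `g`
  have hΓ : N ⬝ᵥ pad yb y2n - Gam g yν ⬝ᵥ N =
      y2n + g (-yν) - fderiv ℝ g (-yν) (yb - yν) := by
    rw [dotProduct_comm, hN, dotProduct_Nvec hn0, dotProduct_Nvec hn0, Gam, lastC_pad hn0,
      lastC_pad hn0, und_pad, und_pad, map_sub]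
    ring
  have hT1 : |g (-yb) - g (-yν) + fderiv ℝ g (-yν) (yb - yν)| ≤ L * δ₁ ^ 2 := by
    have h1 := abs_sub_sub_fderiv_le (r := δ₁) hgd hL0 hL (p := -yν) (a := -yν) (b := -yb)
      (by rw [norm_neg]; linarith) (by rw [norm_neg]; linarith) (by rw [norm_neg]; linarith)
      (by simpa using hδ₁0) (by rwa [neg_sub_neg, norm_sub_rev])
    have h2 : -yb - -yν = -(yb - yν) := by abel
    rw [h2, map_neg, sub_neg_eq_add, norm_neg] at h1
    refine h1.trans ?_
    rw [pow_two, ← mul_assoc]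
    gcongr
  have hT2 : |g (und x - yb) - g (-yb)| ≤ L * (2 * δ₀) * ε := by
    have h1 := abs_sub_sub_fderiv_le (r := 2 * δ₀) hgd hL0 hL (p := 0) (a := -yb)
      (b := und x - yb) (by simp) (by rw [norm_neg]; linarith) (by linarith)
      (by rw [sub_zero, norm_neg]; linarith) (by rw [sub_zero]; linarith)
    have h2 : und x - yb - -yb = und x := by abel
    rw [hgrad0, zero_apply, sub_zero, h2] at h1
    refine h1.trans ?_
    gcongr
  have hval : fderiv ℝ (PhiFun g J S σ τ (pad yb y2n) v) (x, u)
      ((J⁻¹).transpose.mulVec (fun j => N j / eucNorm N),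
        -(∑ j, Gam g yν j * (N j / eucNorm N))) =
      (eucNorm N)⁻¹ * (σ * bilJ J⁻¹ N (Nvec g (yb - und x)) + τ *
        (y2n + g (-yν) - fderiv ℝ g (-yν) (yb - yν) + bilJ J⁻¹ N (S.mulVec x))) := by
    have h1 : (fun j => N j / eucNorm N) = (eucNorm N)⁻¹ • N := by
      funext j
      simp [div_eq_inv_mul]
    have h2 : ∑ j, Gam g yν j * (N j / eucNorm N) = (eucNorm N)⁻¹ * (Gam g yν ⬝ᵥ N) := by
      rw [dotProduct, Finset.mul_sum]
      exact Finset.sum_congr rfl fun j _ => by ring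
    have h3 : bilJ J⁻¹ N (J.mulVec (pad yb y2n)) = N ⬝ᵥ pad yb y2n := by
      rw [bilJ_eq_dotProduct, Matrix.mulVec_mulVec, Matrix.nonsing_inv_mul J hJinv,
        Matrix.one_mulVec]
    rw [fderiv_PhiFun_apply hn0 hgd hSsym, h1, h2, und_pad, Matrix.mulVec_smul,
      smul_dotProduct, smul_dotProduct, smul_dotProduct, hdot, hdot, hdot, h3, ← hΓ]
    simp only [smul_eq_mul]
    ring
  rw [hval, abs_mul, abs_of_nonneg (by positivity)]
  refine (mul_le_of_le_one_left (abs_nonneg _) (inv_le_one_of_one_le₀ hr)).trans ?_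
  refine (abs_add_le _ _).trans ?_
  rw [abs_mul, abs_mul]
  have hsum : |y2n + g (-yν) - fderiv ℝ g (-yν) (yb - yν) + bilJ J⁻¹ N (S.mulVec x)| ≤
      |lastC x - y2n - g (und x - yb)| + L * δ₁ ^ 2 + L * (2 * δ₀) * ε + C₂ * (L * δ₀) * ε := by
    rw [abs_le] at hT1 hT2 hSterm ⊢
    have h1 := neg_abs_le (lastC x - y2n - g (und x - yb))
    have h2 := le_abs_self (lastC x - y2n - g (und x - yb))
    constructor <;> linarith [hT1.1, hT1.2, hT2.1, hT2.2, hSterm.1, hSterm.2]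
  have hfirst : |σ| * |bilJ J⁻¹ N (Nvec g (yb - und x))| ≤ 8 * C₁ * (1 + L) * L * δ₁ ^ 2 :=
    calc _ ≤ 4 * δ₁ * (C₁ * (1 + L) * (L * (2 * δ₁))) := by
          gcongr
          linarith
      _ = _ := by ring
  have hsecond := mul_le_mul hτ hsum (abs_nonneg _) (by norm_num)
  have hLε : L * (ε * δ₀) ≤ L * δ₁ ^ 2 := by gcongr
  have hCLε : C₂ * L * (ε * δ₀) ≤ C₂ * L * δ₁ ^ 2 := by gcongr
  set T := |lastC x - y2n - g (und x - yb)|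
  have hT0 : 0 ≤ T := abs_nonneg _
  have hrest : 0 ≤ (8 * C₁ * (1 + L) * L + 12 * L + 4 * C₂ * L) * T := by positivity
  nlinarith [sq_nonneg δ₁]
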